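/- (Littlewood) For every n ≥ 0, the plethysm h_n[e_2] equals the sum of Schur functions s_λ over all partitions λ of 2n whose conjugate partition λ' has all parts even. -/

import Mathlib

open MvPolynomial

/-- The ring of symmetric functions, modeled as the polynomial ring
`ℚ[h₁, h₂, …]` in the complete homogeneous symmetric functions (variable `i`
corresponds to `h_{i+1}`). -/
abbrev SymF : Type := MvPolynomial ℕ ℚ

/-- The complete homogeneous symmetric function `h_n` as an element of `SymF`. -/
noncomputable def hh : ℕ → SymF
  | 0 => 1
  | n + 1 => X n

/-- The expression of `h_n` in terms of the power sums (in the polynomial ring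
`ℚ[p₁, p₂, …]`, variable `i` corresponding to `p_{i+1}`), via Newton's identity
`n·h_n = ∑_{i=1}^n p_i h_{n-i}`. -/
noncomputable def hInP : ℕ → MvPolynomial ℕ ℚ
  | 0 => 1
  | n + 1 =>
      ((n + 1 : ℚ))⁻¹ • ∑ i ∈ Finset.range (n + 1), X i * hInP (n - i)
  termination_by n => n
  decreasing_by omega

/-- The power sum symmetric function `p_n` as an element of `SymF`, via Newton's
identity `p_n = n·h_n - ∑_{i=1}^{n-1} p_i h_{n-i}`. -/
noncomputable def pSym : ℕ → SymF
  | 0 => 1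
  | n + 1 =>
      ((n : ℚ) + 1) • hh (n + 1) -
        ∑ i ∈ (Finset.range n).attach, pSym (i.1 + 1) * hh (n - i.1)
  termination_by n => n
  decreasing_by
    have h := Finset.mem_range.mp i.2
    omega

/-- The isomorphism expressing a symmetric function in the power sum basis. -/
noncomputable def toP : SymF →ₐ[ℚ] MvPolynomial ℕ ℚ :=
  aeval (fun i => hInP (i + 1))

/-- `psub k g = p_k[g]`, plethysm of a power sum with `g`: substitute `p_i ↦ p_{ik}`
in the power-sum expression of `g`. -/
noncomputable def psub (k : ℕ) (g : SymF) : SymF :=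
  aeval (fun i => pSym ((i + 1) * k)) (toP g)

/-- Plethysm `f[g]` of symmetric functions: substitute `p_k ↦ p_k[g]` in the
power-sum expression of `f`. -/
noncomputable def pleth (f g : SymF) : SymF :=
  aeval (fun i => psub (i + 1) g) (toP f)

/-- `h_z` for integer index: zero for negative `z`. -/
noncomputable def hZ (z : ℤ) : SymF := if 0 ≤ z then hh z.toNat else 0

/-- The Schur function of a partition given as a weakly decreasing list of parts,
defined by the Jacobi–Trudi determinant `s_λ = det(h_{λ_i - i + j})`. -/
noncomputable def schur (l : List ℕ) : SymF :=
  (Matrix.of fun i j : Fin l.length =>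
    hZ ((l.get i : ℤ) + (j : ℤ) - (i : ℤ))).det

/-- `z_λ` for the monomial `d` in the power sums: `∏_i i^{m_i} m_i!`. -/
def zQ (d : ℕ →₀ ℕ) : ℚ :=
  d.prod fun i m => ((i : ℚ) + 1) ^ m * (Nat.factorial m : ℚ)

/-- The Hall inner product, characterized by `⟨p_λ, p_μ⟩ = δ_{λμ} z_λ`, computed in
the power sum basis. -/
noncomputable def hall (f g : SymF) : ℚ :=
  ∑ d ∈ (toP f).support, zQ d * (toP f).coeff d * (toP g).coeff d

/-- The decreasingly sorted list of parts of a partition. -/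
def sortedParts {N : ℕ} (π : Nat.Partition N) : List ℕ :=
  (π.parts.sort (· ≤ ·)).reverse

/-- The geometric series `∑ rⁿ tⁿ`. -/
noncomputable def geomSeries {R : Type*} [CommRing R] (r : R) : PowerSeries R :=
  PowerSeries.mk fun n => r ^ n

section GeomSeries

variable {R : Type*} [CommRing R]

theorem one_sub_mul_geomSeries (r : R) :
    (1 - PowerSeries.C r * PowerSeries.X) * geomSeries r = 1 := by
  ext n
  rw [sub_mul, one_mul, mul_assoc, map_sub, PowerSeries.coeff_C_mul]
  cases n with
  | zero => simp [geomSeries]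
  | succ n =>
    rw [PowerSeries.coeff_succ_X_mul]
    simp [geomSeries, PowerSeries.coeff_one, pow_succ, mul_comm]

theorem coeff_geomSeries (r : R) (n : ℕ) : PowerSeries.coeff n (geomSeries r) = r ^ n := by
  simp [geomSeries]

theorem X_mul_derivative_geomSeries (r : R) :
    PowerSeries.X * PowerSeries.derivative R (geomSeries r) =
      (geomSeries r - 1) * geomSeries r := by
  have h := one_sub_mul_geomSeries r
  have h' := congrArg (PowerSeries.derivative R) h
  rw [Derivation.leibniz, map_sub, Derivation.leibniz] at h'
  simp only [PowerSeries.derivative_one, PowerSeries.derivative_C, PowerSeries.derivative_X,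
    smul_eq_mul, mul_one, mul_zero, add_zero, zero_sub] at h'
  linear_combination PowerSeries.X * geomSeries r * h' -
    (PowerSeries.X * PowerSeries.derivative R (geomSeries r) + geomSeries r) * h

theorem X_mul_derivative_prod {ι : Type*} (s : Finset ι) (f g : ι → PowerSeries R)
    (h : ∀ i ∈ s, PowerSeries.X * PowerSeries.derivative R (f i) = g i * f i) :
    PowerSeries.X * PowerSeries.derivative R (∏ i ∈ s, f i) = (∑ i ∈ s, g i) * ∏ i ∈ s, f i := by
  classical
  induction s using Finset.induction_on with
  | empty => simp
  | insert a s ha ih =>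
    rw [Finset.prod_insert ha, Finset.sum_insert ha, Derivation.leibniz, smul_eq_mul, smul_eq_mul]
    have h1 := h a (Finset.mem_insert_self a s)
    have h2 := ih fun i hi => h i (Finset.mem_insert_of_mem hi)
    linear_combination f a * h2 + (∏ i ∈ s, f i) * h1

theorem coeff_X_mul_derivative (f : PowerSeries R) (n : ℕ) :
    PowerSeries.coeff n (PowerSeries.X * PowerSeries.derivative R f) =
      n * PowerSeries.coeff n f := by
  cases n with
  | zero => simp
  | succ n =>
    rw [PowerSeries.coeff_succ_X_mul, PowerSeries.coeff_derivative]
    push_cast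
    ring

/-- Coefficients of a product with a series whose constant coefficient vanishes. -/
theorem coeff_mul_of_constantCoeff_eq_zero (f g : PowerSeries R)
    (hf : PowerSeries.coeff 0 f = 0) (n : ℕ) :
    PowerSeries.coeff n (f * g) =
      ∑ i ∈ Finset.range n, PowerSeries.coeff (i + 1) f * PowerSeries.coeff (n - 1 - i) g := by
  rw [PowerSeries.coeff_mul, Finset.Nat.sum_antidiagonal_eq_sum_range_succ_mk,
    Finset.sum_range_succ']
  simp only [hf, zero_mul, add_zero]
  refine Finset.sum_congr rfl fun i _ => ?_
  congr 2
  congr 1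
  omega

end GeomSeries

section FourVariables

theorem cross_identity_field {K : Type*} [Field K] (a b c d t : K)
    (h1 : 1 - a * b * t ≠ 0) (h2 : 1 - a * c * t ≠ 0) (h3 : 1 - a * d * t ≠ 0)
    (h4 : 1 - b * c * t ≠ 0) (h5 : 1 - b * d * t ≠ 0) (h6 : 1 - c * d * t ≠ 0) :
    (a - b) * (c - d) * (1 - a * b * t)⁻¹ * (1 - c * d * t)⁻¹ *
        ((1 - a * c * t)⁻¹ + (1 - a * d * t)⁻¹ + (1 - b * c * t)⁻¹ + (1 - b * d * t)⁻¹ - 2)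
      + (a - c) * (d - b) * (1 - a * c * t)⁻¹ * (1 - b * d * t)⁻¹ *
        ((1 - a * d * t)⁻¹ + (1 - a * b * t)⁻¹ + (1 - c * d * t)⁻¹ + (1 - b * c * t)⁻¹ - 2)
      + (a - d) * (b - c) * (1 - a * d * t)⁻¹ * (1 - b * c * t)⁻¹ *
        ((1 - a * b * t)⁻¹ + (1 - a * c * t)⁻¹ + (1 - b * d * t)⁻¹ + (1 - c * d * t)⁻¹ - 2)
      = 0 := by
  field_simp
  ring

theorem cross_identity {R : Type*} [CommRing R] [IsDomain R] (a b c d : R) :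
    PowerSeries.C ((a - b) * (c - d)) * geomSeries (a * b) * geomSeries (c * d) *
        (geomSeries (a * c) + geomSeries (a * d) + geomSeries (b * c) + geomSeries (b * d) - 2)
      + PowerSeries.C ((a - c) * (d - b)) * geomSeries (a * c) * geomSeries (b * d) *
        (geomSeries (a * d) + geomSeries (a * b) + geomSeries (c * d) + geomSeries (b * c) - 2)
      + PowerSeries.C ((a - d) * (b - c)) * geomSeries (a * d) * geomSeries (b * c) *
        (geomSeries (a * b) + geomSeries (a * c) + geomSeries (b * d) + geomSeries (c * d) - 2)
      = 0 := by
  let φ := algebraMap (PowerSeries R) (FractionRing (PowerSeries R))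
  have hφ : Function.Injective φ := IsFractionRing.injective _ _
  have key (u v : R) : φ (geomSeries (u * v)) =
      (1 - φ (PowerSeries.C u) * φ (PowerSeries.C v) * φ PowerSeries.X)⁻¹ ∧
      1 - φ (PowerSeries.C u) * φ (PowerSeries.C v) * φ PowerSeries.X ≠ 0 := by
    have h := congrArg φ (one_sub_mul_geomSeries (u * v))
    simp only [map_mul, map_sub, map_one] at h
    exact ⟨(inv_eq_of_mul_eq_one_right h).symm, left_ne_zero_of_mul_eq_one h⟩
  apply hφ
  simp only [map_add, map_mul, map_sub, map_zero, map_ofNat]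
  simp only [fun u v => (key u v).1]
  exact cross_identity_field _ _ _ _ _ (key a b).2 (key a c).2 (key a d).2 (key b c).2
    (key b d).2 (key c d).2

end FourVariables

section PairSum

variable {R : Type*} [CommRing R]

/-- The signed sum of `U` over all permutations of the variables. -/
noncomputable def altSum {ι : Type*} [Fintype ι] [DecidableEq ι] (U : (ι → R) → PowerSeries R)
    (x : ι → R) : PowerSeries R :=
  ∑ σ : Equiv.Perm ι, (Equiv.Perm.sign σ : ℤ) • U (x ∘ σ)

theorem altSum_comp {ι : Type*} [Fintype ι] [DecidableEq ι] (U : (ι → R) → PowerSeries R)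
    (x : ι → R) (τ : Equiv.Perm ι) :
    altSum (fun y => U (y ∘ τ)) x = (Equiv.Perm.sign τ : ℤ) • altSum U x := by
  unfold altSum
  rw [Finset.smul_sum, ← Equiv.sum_comp (Equiv.mulRight τ)
    fun σ : Equiv.Perm ι => (Equiv.Perm.sign τ : ℤ) • (Equiv.Perm.sign σ : ℤ) • U (x ∘ σ)]
  refine Finset.sum_congr rfl fun σ _ => ?_
  simp only [Equiv.coe_mulRight, Equiv.Perm.sign_mul, Equiv.Perm.coe_mul, smul_smul,
    Function.comp_assoc]
  congr 1
  rcases Int.units_eq_one_or (Equiv.Perm.sign τ) with h | h <;> simp [h]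

theorem mul_altSum {ι : Type*} [Fintype ι] [DecidableEq ι] (f : PowerSeries R)
    (U : (ι → R) → PowerSeries R) (x : ι → R) :
    f * altSum U x = altSum (fun y => f * U y) x := by
  simp only [altSum, Finset.mul_sum, mul_smul_comm]

theorem altSum_swap {ι : Type*} [Fintype ι] [DecidableEq ι] (U V : (ι → R) → PowerSeries R)
    (x : ι → R) {p q : ι} (hpq : p ≠ q) (h : ∀ y, V y = U (y ∘ Equiv.swap p q)) :
    altSum V x = - altSum U x := by
  rw [funext h, altSum_comp, Equiv.Perm.sign_swap hpq]
  simp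

theorem altSum_eq_zero_of_sum_eq_zero [IsDomain R] [CharZero R] {ι : Type*} [Fintype ι]
    [DecidableEq ι] (u : R → R → R → R → PowerSeries R) (rest : (ι → R) → PowerSeries R)
    (x : ι → R) {p q r s : ι} (hpq : p ≠ q) (hpr : p ≠ r) (hps : p ≠ s) (hqr : q ≠ r)
    (hqs : q ≠ s) (hrs : r ≠ s)
    (hrest : ∀ y (τ : Equiv.Perm ι),
      (∀ i, i ≠ p → i ≠ q → i ≠ r → i ≠ s → τ i = i) → rest (y ∘ τ) = rest y)
    (hu : ∀ a b c d,
      (u a b c d - u b a c d - u a b d c + u b a d c)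
      + (u a c d b - u c a d b - u a c b d + u c a b d)
      + (u a d b c - u d a b c - u a d c b + u d a c b) = 0) :
    altSum (fun y => u (y p) (y q) (y r) (y s) * rest y) x = 0 := by
  have hsw : ∀ {i j : ι}, (i = p ∨ i = q ∨ i = r ∨ i = s) → (j = p ∨ j = q ∨ j = r ∨ j = s) →
      ∀ y, rest (y ∘ Equiv.swap i j) = rest y := by
    intro i j hi hj y
    refine hrest y _ fun k h1 h2 h3 h4 => Equiv.swap_apply_of_ne_of_ne ?_ ?_
    · rintro rfl; tauto
    · rintro rfl; tauto
  have T1 (u : R → R → R → R → PowerSeries R) :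
      altSum (fun y => u (y q) (y p) (y r) (y s) * rest y) x =
        -altSum (fun y => u (y p) (y q) (y r) (y s) * rest y) x := by
    refine altSum_swap _ _ x hpq fun y => ?_
    rw [hsw (by tauto) (by tauto)]
    simp [Equiv.swap_apply_of_ne_of_ne, hpr.symm, hps.symm, hqr.symm, hqs.symm]
  have T2 (u : R → R → R → R → PowerSeries R) :
      altSum (fun y => u (y p) (y r) (y q) (y s) * rest y) x =
        -altSum (fun y => u (y p) (y q) (y r) (y s) * rest y) x := by
    refine altSum_swap _ _ x hqr fun y => ?_
    rw [hsw (by tauto) (by tauto)]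
    simp [Equiv.swap_apply_of_ne_of_ne, hpr, hpq, hrs.symm, hqs.symm]
  have T3 (u : R → R → R → R → PowerSeries R) :
      altSum (fun y => u (y p) (y q) (y s) (y r) * rest y) x =
        -altSum (fun y => u (y p) (y q) (y r) (y s) * rest y) x := by
    refine altSum_swap _ _ x hrs fun y => ?_
    rw [hsw (by tauto) (by tauto)]
    simp [Equiv.swap_apply_of_ne_of_ne, hpr, hps, hqr, hqs]
  have h0 : altSum (fun y =>
      ((u (y p) (y q) (y r) (y s) - u (y q) (y p) (y r) (y s)
          - u (y p) (y q) (y s) (y r) + u (y q) (y p) (y s) (y r))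
        + (u (y p) (y r) (y s) (y q) - u (y r) (y p) (y s) (y q)
          - u (y p) (y r) (y q) (y s) + u (y r) (y p) (y q) (y s))
        + (u (y p) (y s) (y q) (y r) - u (y s) (y p) (y q) (y r)
          - u (y p) (y s) (y r) (y q) + u (y s) (y p) (y r) (y q))) * rest y) x = 0 := by
    simp only [hu, zero_mul]
    simp [altSum]
  have hadd (U V : (ι → R) → PowerSeries R) :
      altSum (fun y => U y + V y) x = altSum U x + altSum V x := by
    simp [altSum, Finset.sum_add_distrib]
  have hsub (U V : (ι → R) → PowerSeries R) :
      altSum (fun y => U y - V y) x = altSum U x - altSum V x := by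
    simp [altSum, smul_sub, Finset.sum_sub_distrib]
  simp only [add_mul, sub_mul, hadd, hsub] at h0
  have h_bacd := T1 u
  have h_abdc := T3 u
  have h_badc := T1 fun a b c d => u a b d c
  have h_acbd := T2 u
  have h_acdb := T2 fun a b c d => u a b d c
  have h_adbc := T3 fun a b c d => u a c b d
  have h_adcb := T2 fun a b c d => u a d b c
  have h_cabd := T2 fun a b c d => u b a c d
  have h_cadb := T2 fun a b c d => u b a d c
  have h_dabc := T3 fun a b c d => u c a b d
  have h_dacb := T2 fun a b c d => u d a b c
  rw [h_acdb, h_cadb, h_dacb, h_dabc, h_cabd, h_adcb, h_adbc, h_acbd, h_badc, h_abdc,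
    h_bacd] at h0
  have h12 : (12 : PowerSeries R) *
      altSum (fun y => u (y p) (y q) (y r) (y s) * rest y) x = 0 := by
    linear_combination h0
  have : CharZero (PowerSeries R) :=
    charZero_of_injective_algebraMap (R := R) (A := PowerSeries R) PowerSeries.C_injective
  exact (mul_eq_zero.mp h12).resolve_left (by norm_num)

variable {M : ℕ}

/-- The factor `y_{m,0} / (1 - t y_{m,0} y_{m,1})`. -/
noncomputable def pairTerm (y : Fin M × Fin 2 → R) (m : Fin M) : PowerSeries R :=
  PowerSeries.C (y (m, 0)) * geomSeries (y (m, 0) * y (m, 1))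

/-- The interaction between the pairs `m` and `m'`. -/
noncomputable def crossWeight (m m' : Fin M) (y : Fin M × Fin 2 → R) : PowerSeries R :=
  geomSeries (y (m, 0) * y (m', 0)) + geomSeries (y (m, 0) * y (m', 1)) +
    geomSeries (y (m, 1) * y (m', 0)) + geomSeries (y (m, 1) * y (m', 1)) - 2

theorem altSum_crossWeight [IsDomain R] [CharZero R] {m m' : Fin M} (hm : m ≠ m')
    (x : Fin M × Fin 2 → R) :
    altSum (fun y => crossWeight m m' y * ∏ k, pairTerm y k) x = 0 := by
  have key := altSum_eq_zero_of_sum_eq_zero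
    (fun a b c d : R => (geomSeries (a * c) + geomSeries (a * d) + geomSeries (b * c) +
      geomSeries (b * d) - 2) * ((PowerSeries.C a * geomSeries (a * b)) *
        (PowerSeries.C c * geomSeries (c * d))))
    (fun y : Fin M × Fin 2 → R => ∏ k ∈ (Finset.univ.erase m).erase m', pairTerm y k) x
    (p := (m, 0)) (q := (m, 1)) (r := (m', 0)) (s := (m', 1))
    (by simp) (by simp [hm]) (by simp) (by simp) (by simp [hm]) (by simp) ?_ ?_
  · rw [← key]
    congr 1
    funext y
    rw [← Finset.mul_prod_erase Finset.univ _ (Finset.mem_univ m),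
      ← Finset.mul_prod_erase (Finset.univ.erase m) _
        (Finset.mem_erase.mpr ⟨hm.symm, Finset.mem_univ m'⟩)]
    simp only [crossWeight, pairTerm]
    ring
  · intro y τ hτ
    refine Finset.prod_congr rfl fun k hk => ?_
    simp only [Finset.mem_erase, Finset.mem_univ, and_true] at hk
    simp only [pairTerm, Function.comp_apply]
    rw [hτ (k, 0), hτ (k, 1)] <;> simp [hk.1, hk.2]
  · intro a b c d
    have h := cross_identity a b c d
    simp only [map_mul, map_sub] at h
    simp only [mul_comm b a, mul_comm c a, mul_comm d a, mul_comm c b, mul_comm d b,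
      mul_comm d c]
    linear_combination h

/-- The series `∑ (p_k² - p_{2k}) tᵏ` over `k ≥ 1`. -/
noncomputable def pairSeries {ι : Type*} [Fintype ι] (x : ι → R) : PowerSeries R :=
  (∑ i, ∑ j, (geomSeries (x i * x j) - 1)) - ∑ i, (geomSeries (x i * x i) - 1)

theorem pairSeries_comp {ι κ : Type*} [Fintype ι] [Fintype κ] (x : ι → R) (σ : κ ≃ ι) :
    pairSeries (x ∘ σ) = pairSeries x := by
  unfold pairSeries
  simp only [Function.comp_apply]
  rw [σ.sum_comp fun i => ∑ j, (geomSeries (x i * x (σ j)) - 1),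
    σ.sum_comp fun i => geomSeries (x i * x i) - 1]
  congr 1
  exact Finset.sum_congr rfl fun i _ => σ.sum_comp fun j => geomSeries (x i * x j) - 1

theorem pairSeries_eq (y : Fin M × Fin 2 → R) :
    pairSeries y + 2 * ((M : PowerSeries R) * (M - 1 : PowerSeries R)) =
      2 * ∑ m, (geomSeries (y (m, 0) * y (m, 1)) - 1) +
        ∑ m, ∑ m' ∈ Finset.univ.erase m, crossWeight m m' y := by
  have h1 (m : Fin M) : ∑ m' ∈ Finset.univ.erase m, crossWeight m m' y =
      (∑ m', (crossWeight m m' y - 2)) - (crossWeight m m y - 2) + 2 * (M - 1) := by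
    rw [← Finset.add_sum_erase Finset.univ (fun m' => crossWeight m m' y - 2) (Finset.mem_univ m),
      Finset.sum_sub_distrib]
    have hM : 1 ≤ M := m.pos
    simp [Finset.card_erase_of_mem, Nat.cast_sub hM]
    ring
  simp only [h1, Finset.sum_add_distrib, Finset.sum_sub_distrib]
  unfold pairSeries
  simp only [Fintype.sum_prod_type, Fin.sum_univ_two, Finset.sum_add_distrib,
    Finset.sum_sub_distrib, crossWeight, Finset.sum_const, Finset.card_univ, Fintype.card_fin,
    Fintype.card_prod, Nat.cast_mul, Nat.cast_ofNat,
    nsmul_eq_mul, mul_comm (y (_, 1)) (y (_, 0))]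
  ring

theorem X_mul_derivative_altSum [IsDomain R] [CharZero R] (x : Fin M × Fin 2 → R) :
    2 * (PowerSeries.X * PowerSeries.derivative R (altSum (fun y => ∏ k, pairTerm y k) x)) =
      (pairSeries x + 2 * ((M : PowerSeries R) * (M - 1 : PowerSeries R))) *
        altSum (fun y => ∏ k, pairTerm y k) x := by
  have hterm (y : Fin M × Fin 2 → R) : PowerSeries.X * PowerSeries.derivative R
      (∏ k, pairTerm y k) =
        (∑ m, (geomSeries (y (m, 0) * y (m, 1)) - 1)) * ∏ k, pairTerm y k := by
    refine X_mul_derivative_prod _ _ _ fun m _ => ?_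
    rw [pairTerm, Derivation.leibniz]
    simp only [PowerSeries.derivative_C, smul_eq_mul, mul_zero, add_zero]
    linear_combination PowerSeries.C (y (m, 0)) *
      X_mul_derivative_geomSeries (y (m, 0) * y (m, 1))
  have hcross : ∑ m : Fin M, ∑ m' ∈ Finset.univ.erase m,
      altSum (fun y => crossWeight m m' y * ∏ k, pairTerm y k) x = 0 :=
    Finset.sum_eq_zero fun m _ => Finset.sum_eq_zero fun m' hm' =>
      altSum_crossWeight (Finset.ne_of_mem_erase hm').symm x
  have hL : 2 * (PowerSeries.X * PowerSeries.derivative R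
      (altSum (fun y => ∏ k, pairTerm y k) x)) =
      altSum (fun y => 2 * ((∑ m, (geomSeries (y (m, 0) * y (m, 1)) - 1)) *
        ∏ k, pairTerm y k)) x := by
    rw [← mul_altSum, altSum, map_sum, Finset.mul_sum, altSum]
    refine congrArg (2 * ·) (Finset.sum_congr rfl fun σ _ => ?_)
    rw [map_zsmul, mul_smul_comm, hterm]
  have hR : (pairSeries x + 2 * ((M : PowerSeries R) * (M - 1 : PowerSeries R))) *
        altSum (fun y => ∏ k, pairTerm y k) x =
      altSum (fun y => (pairSeries y + 2 * ((M : PowerSeries R) * (M - 1 : PowerSeries R))) *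
        ∏ k, pairTerm y k) x := by
    rw [mul_altSum]
    exact Finset.sum_congr rfl fun σ _ => by simp only [pairSeries_comp]
  rw [hL, hR]
  simp only [pairSeries_eq]
  rw [← sub_eq_zero, ← neg_eq_zero, ← hcross]
  simp only [altSum, add_mul, Finset.sum_mul, smul_add, Finset.sum_add_distrib, mul_assoc,
    Finset.smul_sum, Finset.mul_sum]
  rw [neg_sub, add_sub_cancel_left, Finset.sum_comm]
  refine Finset.sum_congr rfl fun m _ => ?_
  rw [Finset.sum_comm]

end PairSum

section PairSumCoeff

variable {R : Type*} [CommRing R]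

/-- The alternant `det (x_v ^ β_i)`. -/
noncomputable def alternant {ι : Type*} [Fintype ι] [DecidableEq ι] (x : ι → R) (β : ι → ℕ) : R :=
  (Matrix.of fun v i => x v ^ β i).det

theorem alternant_eq_zero {ι : Type*} [Fintype ι] [DecidableEq ι] (x : ι → R) {β : ι → ℕ}
    {i j : ι} (hij : i ≠ j) (h : β i = β j) : alternant x β = 0 :=
  Matrix.det_zero_of_column_eq hij fun v => by simp [h]

theorem alternant_comp {ι κ : Type*} [Fintype ι] [DecidableEq ι] [Fintype κ] [DecidableEq κ]
    (e : κ ≃ ι) (x : ι → R) (β : ι → ℕ) : alternant (x ∘ e) (β ∘ e) = alternant x β := by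
  unfold alternant
  rw [← Matrix.det_submatrix_equiv_self e]
  rfl

theorem alternant_comp_perm {ι : Type*} [Fintype ι] [DecidableEq ι] (x : ι → R) (β : ι → ℕ)
    (τ : Equiv.Perm ι) :
    alternant x (β ∘ τ) = ((Equiv.Perm.sign τ : ℤ) : R) * alternant x β := by
  unfold alternant
  rw [← Matrix.det_permute']
  rfl

variable {M : ℕ}

/-- The exponents `c_m + 1, c_m` attached to the two members of the pair `m`. -/
def pairExp (c : Fin M → ℕ) (i : Fin M × Fin 2) : ℕ := c i.1 + (1 - i.2.val)

theorem coeff_altSum (x : Fin M × Fin 2 → R) (n : ℕ) :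
    PowerSeries.coeff n (altSum (fun y => ∏ k, pairTerm y k) x) =
      ∑ c ∈ Finset.univ.finsuppAntidiag n, alternant x (pairExp (c : Fin M →₀ ℕ)) := by
  unfold altSum alternant
  simp only [Matrix.det_apply, map_sum, map_zsmul, PowerSeries.coeff_prod, Finset.smul_sum]
  rw [Finset.sum_comm]
  refine Finset.sum_congr rfl fun c _ => Finset.sum_congr rfl fun σ _ => ?_
  rw [Units.smul_def, Fintype.prod_prod_type]
  congr 1
  refine Finset.prod_congr rfl fun m _ => ?_
  simp only [pairTerm, PowerSeries.coeff_C_mul, coeff_geomSeries, Fin.prod_univ_two,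
    Matrix.of_apply, pairExp, Function.comp_apply]
  simp
  ring

theorem coeff_pairSeries {ι : Type*} [Fintype ι] (x : ι → R) (k : ℕ) :
    PowerSeries.coeff (k + 1) (pairSeries x) =
      (∑ i, x i ^ (k + 1)) ^ 2 - ∑ i, x i ^ (2 * (k + 1)) := by
  simp only [pairSeries, map_sub, map_sum, coeff_geomSeries, PowerSeries.coeff_one]
  simp only [Nat.add_eq_zero_iff, one_ne_zero, and_false, if_false, sub_zero, mul_pow, sq,
    Finset.sum_mul_sum, ← pow_add, two_mul]

theorem coeff_zero_pairSeries {ι : Type*} [Fintype ι] (x : ι → R) :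
    PowerSeries.coeff 0 (pairSeries x) = 0 := by
  simp only [pairSeries, map_sub, map_sum, coeff_geomSeries, PowerSeries.coeff_one]
  simp

theorem coeff_altSum_recursion [IsDomain R] [CharZero R] (x : Fin M × Fin 2 → R) (n : ℕ) :
    2 * ((n : R) - M * (M - 1)) *
        PowerSeries.coeff n (altSum (fun y => ∏ k, pairTerm y k) x) =
      ∑ i ∈ Finset.range n, ((∑ v, x v ^ (i + 1)) ^ 2 - ∑ v, x v ^ (2 * (i + 1))) *
        PowerSeries.coeff (n - 1 - i) (altSum (fun y => ∏ k, pairTerm y k) x) := by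
  have h := congrArg (PowerSeries.coeff n) (X_mul_derivative_altSum x)
  have h2 : (2 : PowerSeries R) = PowerSeries.C 2 := (map_ofNat PowerSeries.C 2).symm
  have hM : 2 * ((M : PowerSeries R) * (M - 1 : PowerSeries R)) =
      PowerSeries.C (2 * ((M : R) * (M - 1))) := by simp [h2]
  rw [add_mul, hM, h2, map_add, PowerSeries.coeff_C_mul, PowerSeries.coeff_C_mul,
    coeff_X_mul_derivative,
    coeff_mul_of_constantCoeff_eq_zero _ _ (coeff_zero_pairSeries x)] at h
  simp only [coeff_pairSeries] at h
  linear_combination h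

theorem coeff_altSum_eq [IsDomain R] [CharZero R] (x : Fin M × Fin 2 → R) (a : ℕ → R)
    (ha0 : a 0 = 1)
    (ha : ∀ n : ℕ, 2 * ((n : R) + 1) * a (n + 1) = ∑ i ∈ Finset.range (n + 1),
      ((∑ v, x v ^ (i + 1)) ^ 2 - ∑ v, x v ^ (2 * (i + 1))) * a (n - i)) (n : ℕ) :
    PowerSeries.coeff (n + M * (M - 1)) (altSum (fun y => ∏ k, pairTerm y k) x) =
      a n * PowerSeries.coeff (M * (M - 1)) (altSum (fun y => ∏ k, pairTerm y k) x) := by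
  have hcast : ((M * (M - 1) : ℕ) : R) = M * (M - 1) := by
    cases M <;> simp
  have hlow : ∀ k < M * (M - 1),
      PowerSeries.coeff k (altSum (fun y => ∏ k, pairTerm y k) x) = 0 := by
    intro k
    induction k using Nat.strong_induction_on with
    | _ k ih =>
      intro hk
      have h := coeff_altSum_recursion x k
      rw [Finset.sum_eq_zero] at h
      · refine (mul_eq_zero.mp h).resolve_left (mul_ne_zero two_ne_zero ?_)
        rw [← hcast, sub_ne_zero]
        exact_mod_cast hk.ne
      · intro i hi
        have := Finset.mem_range.mp hi
        rw [ih _ (by omega) (by omega), mul_zero]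
  induction n using Nat.strong_induction_on with
  | _ n ih =>
    cases n with
    | zero => simp [ha0]
    | succ n =>
      have h := coeff_altSum_recursion x (n + 1 + M * (M - 1))
      rw [Finset.sum_range_add, Finset.sum_eq_zero (s := Finset.range (M * (M - 1))), add_zero] at h
      · have h2 : (2 * ((n : R) + 1)) ≠ 0 := mul_ne_zero two_ne_zero (Nat.cast_add_one_ne_zero n)
        apply mul_left_cancel₀ h2
        rw [← mul_assoc, ha, Finset.sum_mul]
        push_cast [hcast] at h
        rw [Finset.sum_congr rfl fun i hi => ?_] at h
        · rw [← h]
          ring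
        · have := Finset.mem_range.mp hi
          rw [show n + 1 + M * (M - 1) - 1 - i = n - i + M * (M - 1) by omega,
            ih (n - i) (by omega), ← mul_assoc]
      · intro i hi
        have := Finset.mem_range.mp hi
        rw [hlow _ (by omega), mul_zero]

end PairSumCoeff

section PairSumSorted

variable {R : Type*} [CommRing R] {M : ℕ}

theorem alternant_pairExp_comp (x : Fin M × Fin 2 → R) (c : Fin M → ℕ) (τ : Equiv.Perm (Fin M)) :
    alternant x (pairExp (c ∘ τ)) = alternant x (pairExp c) := by
  have h := alternant_comp_perm x (pairExp c) (Equiv.prodCongrLeft fun _ : Fin 2 => τ)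
  rw [Equiv.Perm.sign_prodCongrLeft] at h
  have hs : (∏ _k : Fin 2, Equiv.Perm.sign τ) = 1 := by
    rw [Fin.prod_univ_two]
    exact Int.units_mul_self _
  rw [hs] at h
  rw [show pairExp (c ∘ τ) = pairExp c ∘ Equiv.prodCongrLeft fun _ : Fin 2 => τ from rfl, h]
  simp

/-- The strictly decreasing sequence `d_m + 2 (M - 1 - m)`. -/
def spread (d : Fin M → ℕ) (m : Fin M) : ℕ := d m + 2 * (M - 1 - m.val)

theorem spread_gap {d : Fin M → ℕ} (hd : Antitone d) {m m' : Fin M} (h : m < m') :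
    spread d m' + 2 ≤ spread d m := by
  have h1 := hd h.le
  have h2 : m.val < m'.val := h
  have h3 := m'.isLt
  unfold spread
  omega

theorem strictAnti_spread {d : Fin M → ℕ} (hd : Antitone d) : StrictAnti (spread d) :=
  fun m m' h => by have := spread_gap hd h; omega

theorem spread_injective : Function.Injective (spread (M := M)) := by
  intro d d' h
  funext m
  have := congrFun h m
  unfold spread at this
  omega

theorem sum_spread (d : Fin M → ℕ) : ∑ m, spread d m = ∑ m, d m + M * (M - 1) := by
  simp only [spread, Finset.sum_add_distrib]
  rw [← Finset.mul_sum, Fin.sum_univ_eq_sum_range fun m => M - 1 - m,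
    Finset.sum_range_reflect fun m => m, mul_comm 2, Finset.sum_range_id_mul_two]

theorem exists_spread_eq {f : Fin M → ℕ} (hf : ∀ m m', m < m' → f m' + 2 ≤ f m) :
    ∃ d, Antitone d ∧ spread d = f := by
  have key : ∀ (k : ℕ) (m m' : Fin M), m'.val = m.val + k → f m' + 2 * k ≤ f m := by
    intro k
    induction k with
    | zero =>
      intro m m' h
      rw [Fin.ext h]
      simp
    | succ k ih =>
      intro m m' h
      have hlt : m.val + k < M := by have := m'.isLt; omega
      have h1 := ih m ⟨m.val + k, hlt⟩ rfl
      have h2 := hf ⟨m.val + k, hlt⟩ m' (by rw [Fin.lt_def]; simp only; omega)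
      omega
  have hlast : ∀ m : Fin M, 2 * (M - 1 - m.val) ≤ f m := fun m => by
    have hm := m.isLt
    have := key (M - 1 - m.val) m ⟨M - 1, by omega⟩ (by simp only; omega)
    omega
  refine ⟨fun m => f m - 2 * (M - 1 - m.val), fun m m' h => ?_, funext fun m => ?_⟩
  · have h' : m.val ≤ m'.val := h
    have h1 := key (m'.val - m.val) m m' (by omega)
    have h2 := hlast m
    have h3 := hlast m'
    have h4 := m'.isLt
    simp only
    omega
  · have := hlast m
    simp only [spread]
    omega

/-- Weakly decreasing sequences of length `M` with sum `n`. -/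
def decSeq (M n : ℕ) : Finset (Fin M → ℕ) :=
  (Finset.piAntidiag Finset.univ n).filter fun d => ∀ i j, i ≤ j → d j ≤ d i

theorem mem_decSeq {n : ℕ} {d : Fin M → ℕ} : d ∈ decSeq M n ↔ ∑ m, d m = n ∧ Antitone d := by
  simp [decSeq, Antitone]

theorem sum_alternant_pairExp (x : Fin M × Fin 2 → R) (n : ℕ) :
    ∑ c ∈ Finset.univ.finsuppAntidiag (n + M * (M - 1)),
        alternant x (pairExp (c : Fin M →₀ ℕ)) =
      (M.factorial : R) * ∑ d ∈ decSeq M n, alternant x (pairExp (spread d)) := by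
  classical
  have hR : (M.factorial : R) * ∑ d ∈ decSeq M n, alternant x (pairExp (spread d)) =
      ∑ p ∈ decSeq M n ×ˢ (Finset.univ : Finset (Equiv.Perm (Fin M))),
        alternant x (pairExp (spread p.1)) := by
    rw [Finset.sum_product]
    simp [Finset.card_univ, Fintype.card_perm, Finset.mul_sum]
  have hL := Finset.sum_filter_of_ne (s := Finset.univ.finsuppAntidiag (n + M * (M - 1)))
    (f := fun c : Fin M →₀ ℕ => alternant x (pairExp c))
    (p := fun c => ∀ m m', m ≠ m' → c m ≠ c m' ∧ c m ≠ c m' + 1) <| by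
      intro c _ hc m m' hm
      refine ⟨fun h => hc ?_, fun h => hc ?_⟩
      · exact alternant_eq_zero x (i := (m, 0)) (j := (m', 0)) (by simp [hm]) (by simp [pairExp, h])
      · exact alternant_eq_zero x (i := (m, 1)) (j := (m', 0)) (by simp) (by simp [pairExp, h])
  rw [hR, ← hL]
  symm
  refine Finset.sum_bij (fun p _ => Finsupp.equivFunOnFinite.symm (spread p.1 ∘ p.2)) ?_ ?_ ?_ ?_
  · rintro ⟨d, τ⟩ hp
    obtain ⟨hd, -⟩ := Finset.mem_product.mp hp
    rw [mem_decSeq] at hd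
    simp only [Finset.mem_filter, Finset.mem_finsuppAntidiag,
      Finsupp.equivFunOnFinite_symm_apply_apply,
      Function.comp_apply, Finset.subset_univ, and_true]
    refine ⟨?_, fun m m' hm => ?_⟩
    · rw [Equiv.sum_comp τ (spread d), sum_spread, hd.1]
    · rcases lt_or_gt_of_ne (τ.injective.ne hm) with h | h <;>
      · have := spread_gap hd.2 h
        simp only at this ⊢
        omega
  · rintro ⟨d, τ⟩ hp ⟨d', τ'⟩ hp' h
    obtain ⟨hd, -⟩ := Finset.mem_product.mp hp
    obtain ⟨hd', -⟩ := Finset.mem_product.mp hp'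
    rw [mem_decSeq] at hd hd'
    replace h : spread d ∘ τ = spread d' ∘ τ' := Finsupp.equivFunOnFinite.symm.injective h
    have hρ (m : Fin M) : spread d m = spread d' (τ' (τ.symm m)) := by
      simpa using congrFun h (τ.symm m)
    have hmono : StrictMono fun m => τ' (τ.symm m) := fun m m' hm => by
      rw [← (strictAnti_spread hd'.2).lt_iff_gt, ← hρ, ← hρ]
      exact strictAnti_spread hd.2 hm
    have hid : (fun m => τ' (τ.symm m)) = id := (StrictMono.range_inj hmono strictMono_id).mp <| by
      rw [Set.range_id]
      exact (τ.symm.trans τ').surjective.range_eq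
    have hτ : τ = τ' := by
      ext m
      simpa using congrArg Fin.val (congrFun hid (τ m)).symm
    subst hτ
    have : d = d' := spread_injective <| funext fun m => by simpa using hρ m
    rw [this]
  · intro c hc
    simp only [Finset.mem_filter, Finset.mem_finsuppAntidiag, Finset.subset_univ, and_true] at hc
    let τ := Tuple.sort (OrderDual.toDual ∘ c)
    have hτ : Antitone (c ∘ τ) := Tuple.monotone_sort (OrderDual.toDual ∘ c)
    obtain ⟨d, hd, hdc⟩ := exists_spread_eq (f := c ∘ τ) fun m m' hm => by
      have h1 := hc.2 _ _ (τ.injective.ne hm.ne)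
      have h2 : c (τ m') ≤ c (τ m) := hτ hm.le
      simp only [Function.comp_apply]
      omega
    refine ⟨(d, τ.symm), ?_, ?_⟩
    · rw [Finset.mem_product, mem_decSeq]
      refine ⟨⟨?_, hd⟩, Finset.mem_univ _⟩
      have h1 := sum_spread d
      have h2 : ∑ m, spread d m = ∑ m, c m := by
        rw [hdc]
        exact Equiv.sum_comp τ c
      have h3 : ∑ m, c m = n + M * (M - 1) := hc.1
      simp only
      omega
    · ext m
      simp [hdc]
  · rintro ⟨d, τ⟩ _
    exact (alternant_pairExp_comp x (spread d) τ).symm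

end PairSumSorted

section JacobiTrudi

variable {R : Type*} [CommRing R]

/-- The generating series `∏ (1 - x_i t)⁻¹` of the complete homogeneous symmetric functions. -/
noncomputable def hSeries {ι : Type*} [Fintype ι] (x : ι → R) : PowerSeries R :=
  ∏ i, geomSeries (x i)

theorem coeff_zero_hSeries {ι : Type*} [Fintype ι] (x : ι → R) :
    PowerSeries.coeff 0 (hSeries x) = 1 := by
  rw [hSeries, PowerSeries.coeff_zero_eq_constantCoeff_apply, map_prod]
  refine Finset.prod_eq_one fun i _ => ?_
  rw [← PowerSeries.coeff_zero_eq_constantCoeff_apply, coeff_geomSeries, pow_zero]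

theorem coeff_hSeries_recursion {ι : Type*} [Fintype ι] (x : ι → R) (n : ℕ) :
    ((n : R) + 1) * PowerSeries.coeff (n + 1) (hSeries x) =
      ∑ i ∈ Finset.range (n + 1), (∑ v, x v ^ (i + 1)) * PowerSeries.coeff (n - i) (hSeries x) := by
  have h := congrArg (PowerSeries.coeff (n + 1)) <| X_mul_derivative_prod Finset.univ
    (fun i => geomSeries (x i)) (fun i => geomSeries (x i) - 1)
    fun i _ => X_mul_derivative_geomSeries (x i)
  rw [coeff_X_mul_derivative, coeff_mul_of_constantCoeff_eq_zero] at h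
  · push_cast at h
    rw [hSeries, h]
    simp only [map_sum, map_sub, coeff_geomSeries, PowerSeries.coeff_one]
    simp
  · simp only [map_sum, map_sub, coeff_geomSeries, PowerSeries.coeff_one]
    simp

theorem coeff_prod_one_sub_C_mul_X {ι : Type*} (s : Finset ι) (x : ι → R) {k : ℕ}
    (hk : s.card < k) :
    PowerSeries.coeff k (∏ i ∈ s, (1 - PowerSeries.C (x i) * PowerSeries.X)) = 0 := by
  classical
  induction s using Finset.induction_on generalizing k with
  | empty =>
    have : k ≠ 0 := by simpa [Nat.pos_iff_ne_zero] using hk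
    simp [PowerSeries.coeff_one, this]
  | insert a s ha ih =>
    rw [Finset.card_insert_of_notMem ha] at hk
    obtain ⟨k, rfl⟩ : ∃ j, k = j + 1 := ⟨k - 1, by omega⟩
    rw [Finset.prod_insert ha, sub_mul, one_mul, mul_assoc, map_sub, PowerSeries.coeff_C_mul,
      PowerSeries.coeff_succ_X_mul, ih (by omega), ih (by omega)]
    simp

variable [Algebra ℚ R]

/-- Evaluation of a symmetric function at finitely many variables. -/
noncomputable def evalSym {ι : Type*} [Fintype ι] (x : ι → R) : SymF →ₐ[ℚ] R :=
  aeval fun i => PowerSeries.coeff (i + 1) (hSeries x)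

theorem evalSym_hh {ι : Type*} [Fintype ι] (x : ι → R) (n : ℕ) :
    evalSym x (hh n) = PowerSeries.coeff n (hSeries x) := by
  cases n with
  | zero => simp [hh, -PowerSeries.coeff_zero_eq_constantCoeff, coeff_zero_hSeries]
  | succ n => simp [hh, evalSym]

theorem hZ_natCast (n : ℕ) : hZ n = hh n := by simp [hZ]

theorem hZ_of_neg {z : ℤ} (hz : z < 0) : hZ z = 0 := by simp [hZ, hz]

theorem hZ_zero : hZ 0 = 1 := by simp [hZ, hh]

variable {N : ℕ}

/-- Signed elementary symmetric functions in all variables but `x_v`. -/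
noncomputable def signedEsymmErase (x : Fin N → R) (v : Fin N) (k : ℕ) : R :=
  PowerSeries.coeff k (∏ w ∈ Finset.univ.erase v, (1 - PowerSeries.C (x w) * PowerSeries.X))

theorem pow_eq_sum_signedEsymmErase (x : Fin N → R) (v : Fin N) (a : ℕ) :
    x v ^ a = ∑ k ∈ Finset.range N,
      signedEsymmErase x v k * evalSym x (hZ ((a : ℤ) - k)) := by
  have hgeom : geomSeries (x v) =
      (∏ w ∈ Finset.univ.erase v, (1 - PowerSeries.C (x w) * PowerSeries.X)) * hSeries x := by
    rw [hSeries, ← Finset.prod_erase_mul _ _ (Finset.mem_univ v), ← mul_assoc,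
      ← Finset.prod_mul_distrib]
    simp [one_sub_mul_geomSeries]
  have hcard : (Finset.univ.erase v).card = N - 1 := by simp
  have hN : 0 < N := v.pos
  have h1 : ∑ k ∈ Finset.range N, signedEsymmErase x v k * evalSym x (hZ ((a : ℤ) - k)) =
      ∑ k ∈ Finset.range (a + 1 + N), signedEsymmErase x v k * evalSym x (hZ ((a : ℤ) - k)) := by
    refine Finset.sum_subset (Finset.range_subset_range.mpr (by omega)) fun k _ hk => ?_
    have hk' : N ≤ k := by simpa using hk
    rw [signedEsymmErase, coeff_prod_one_sub_C_mul_X _ _ (by omega), zero_mul]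
  have h2 : ∑ k ∈ Finset.range (a + 1), signedEsymmErase x v k * evalSym x (hZ ((a : ℤ) - k)) =
      ∑ k ∈ Finset.range (a + 1 + N), signedEsymmErase x v k * evalSym x (hZ ((a : ℤ) - k)) := by
    refine Finset.sum_subset (Finset.range_subset_range.mpr (by omega)) fun k _ hk => ?_
    have hk' : a < k := by simpa using hk
    rw [hZ_of_neg (by omega), map_zero, mul_zero]
  rw [h1, ← h2, ← coeff_geomSeries, hgeom, PowerSeries.coeff_mul,
    Finset.Nat.sum_antidiagonal_eq_sum_range_succ_mk]
  refine Finset.sum_congr rfl fun k hk => ?_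
  have hk' : k ≤ a := by simpa [Nat.lt_succ_iff] using hk
  rw [← Nat.cast_sub hk', hZ_natCast, evalSym_hh]
  rfl

/-- The Jacobi–Trudi matrix of a sequence of `N` parts. -/
noncomputable def jacobiTrudi (l : Fin N → ℕ) : Matrix (Fin N) (Fin N) SymF :=
  Matrix.of fun i j => hZ ((l i : ℤ) + (j : ℤ) - (i : ℤ))

theorem alternant_eq_mul (x : Fin N → R) (l : Fin N → ℕ) :
    alternant x (fun i => l i + (N - 1 - i.val)) =
      (Matrix.of fun v j : Fin N => signedEsymmErase x v (N - 1 - j.val)).det *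
        evalSym x (jacobiTrudi l).det := by
  rw [AlgHom.map_det, ← Matrix.det_transpose ((evalSym x).mapMatrix _), ← Matrix.det_mul]
  unfold alternant
  congr 1
  ext v i
  rw [Matrix.mul_apply, Matrix.of_apply, pow_eq_sum_signedEsymmErase,
    ← Finset.sum_range_reflect, ← Fin.sum_univ_eq_sum_range fun j =>
      signedEsymmErase x v (N - 1 - j) *
        evalSym x (hZ (((l i + (N - 1 - i.val) : ℕ) : ℤ) - (N - 1 - j : ℕ)))]
  refine Finset.sum_congr rfl fun j _ => ?_
  have hi := i.isLt
  have hj := j.isLt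
  simp only [Matrix.of_apply, Matrix.transpose_apply, AlgHom.mapMatrix_apply, Matrix.map_apply,
    jacobiTrudi]
  congr 3
  omega

theorem det_jacobiTrudi_zero : (jacobiTrudi (0 : Fin N → ℕ)).det = 1 := by
  rw [Matrix.det_of_isUpperTriangular]
  · refine Finset.prod_eq_one fun i _ => ?_
    simp [jacobiTrudi, hZ_zero]
  · intro i j hij
    have : j.val < i.val := hij
    simp only [jacobiTrudi, Matrix.of_apply]
    exact hZ_of_neg (by simp only [Pi.zero_apply]; omega)

/-- The ratio-of-alternants form of the Jacobi–Trudi identity. -/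
theorem alternant_eq_evalSym_mul (x : Fin N → R) (l : Fin N → ℕ) :
    alternant x (fun i => l i + (N - 1 - i.val)) =
      evalSym x (jacobiTrudi l).det * alternant x (fun i : Fin N => N - 1 - i.val) := by
  have h0 := alternant_eq_mul x (0 : Fin N → ℕ)
  rw [det_jacobiTrudi_zero, map_one, mul_one] at h0
  simp only [Pi.zero_apply, zero_add] at h0
  rw [alternant_eq_mul, h0, mul_comm]

theorem schur_eq_det_jacobiTrudi (l : List ℕ) (h : l.length ≤ N) :
    schur l = (jacobiTrudi fun i : Fin N => l.getD i 0).det := by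
  obtain ⟨r, rfl⟩ := Nat.exists_eq_add_of_le h
  rw [← Matrix.det_submatrix_equiv_self finSumFinEquiv, ← Matrix.fromBlocks_toBlocks
    ((jacobiTrudi fun i : Fin (l.length + r) => l.getD i 0).submatrix _ _)]
  have h21 : ((jacobiTrudi fun i : Fin (l.length + r) => l.getD i 0).submatrix
      finSumFinEquiv finSumFinEquiv).toBlocks₂₁ = 0 := by
    ext1 i j
    have := j.isLt
    simp only [Matrix.toBlocks₂₁, jacobiTrudi, Matrix.of_apply, Matrix.submatrix_apply,
      finSumFinEquiv_apply_left, finSumFinEquiv_apply_right, Fin.val_natAdd, Fin.val_castAdd]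
    rw [List.getD_eq_default _ _ (by omega)]
    exact hZ_of_neg (by push_cast; omega)
  have h22 : ((jacobiTrudi fun i : Fin (l.length + r) => l.getD i 0).submatrix
      finSumFinEquiv finSumFinEquiv).toBlocks₂₂ = jacobiTrudi (0 : Fin r → ℕ) := by
    ext1 i j
    simp only [Matrix.toBlocks₂₂, jacobiTrudi, Matrix.of_apply, Matrix.submatrix_apply,
      finSumFinEquiv_apply_right, Fin.val_natAdd, Pi.zero_apply]
    rw [List.getD_eq_default _ _ (by omega)]
    congr 1
    push_cast
    ring
  rw [h21, Matrix.det_fromBlocks_zero₂₁, h22, det_jacobiTrudi_zero, mul_one, schur]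
  congr 1
  ext1 i j
  simp [Matrix.toBlocks₁₁, jacobiTrudi]

end JacobiTrudi

section EvalSym

theorem toP_hh (n : ℕ) : toP (hh n) = hInP n := by
  cases n with
  | zero => simp [hh, hInP]
  | succ n => simp [hh, toP]

theorem hInP_succ (n : ℕ) :
    hInP (n + 1) = ((n + 1 : ℚ))⁻¹ • ∑ i ∈ Finset.range (n + 1), X i * hInP (n - i) := by
  rw [hInP]

theorem pSym_succ (n : ℕ) :
    pSym (n + 1) = ((n : ℚ) + 1) • hh (n + 1) -
      ∑ i ∈ Finset.range n, pSym (i + 1) * hh (n - i) := by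
  rw [pSym, Finset.sum_attach (Finset.range n) fun i => pSym (i + 1) * hh (n - i)]

variable {R : Type*} [CommRing R] [Algebra ℚ R] {ι : Type*} [Fintype ι]

theorem evalSym_pSym (x : ι → R) (n : ℕ) : evalSym x (pSym (n + 1)) = ∑ v, x v ^ (n + 1) := by
  induction n using Nat.strong_induction_on with
  | _ n ih =>
    have h := coeff_hSeries_recursion x n
    rw [Finset.sum_range_succ, Nat.sub_self, coeff_zero_hSeries, mul_one] at h
    rw [pSym_succ, map_sub, map_smul, map_sum, Finset.sum_congr rfl fun i hi => by
      rw [map_mul, ih i (Finset.mem_range.mp hi), evalSym_hh], evalSym_hh, Algebra.smul_def]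
    rw [sub_eq_iff_eq_add', ← h]
    simp

theorem two_mul_evalSym_psub (x : ι → R) (k : ℕ) :
    2 * evalSym x (psub (k + 1) (hh 1 * hh 1 - hh 2)) =
      (∑ v, x v ^ (k + 1)) ^ 2 - ∑ v, x v ^ (2 * (k + 1)) := by
  have h0 : hInP 0 = 1 := by rw [hInP]
  have h1 : hInP 1 = X 0 := by simp [hInP_succ 0, h0]
  have h2 : (2 : MvPolynomial ℕ ℚ) * hInP 2 = X 0 * X 0 + X 1 := by
    rw [hInP_succ 1, Algebra.smul_def, ← mul_assoc]
    have : (2 : MvPolynomial ℕ ℚ) * algebraMap ℚ (MvPolynomial ℕ ℚ) (((1 : ℕ) : ℚ) + 1)⁻¹ = 1 := by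
      rw [← map_ofNat (algebraMap ℚ (MvPolynomial ℕ ℚ)) 2, ← map_mul]
      norm_num
    rw [this, one_mul, Finset.sum_range_succ, Finset.sum_range_one]
    simp [h0, h1]
  have h3 : 2 * toP (hh 1 * hh 1 - hh 2) = X 0 * X 0 - X 1 := by
    rw [map_sub, map_mul, toP_hh, toP_hh, h1]
    linear_combination -h2
  have h4 : 2 * psub (k + 1) (hh 1 * hh 1 - hh 2) =
      pSym (k + 1) * pSym (k + 1) - pSym (2 * (k + 1)) := by
    unfold psub
    rw [← map_ofNat (aeval (R := ℚ) (fun i => pSym ((i + 1) * (k + 1))) :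
      MvPolynomial ℕ ℚ →ₐ[ℚ] SymF) 2, ← map_mul, h3]
    simp
  have h5 := congrArg (evalSym x) h4
  rw [map_mul, map_sub, map_mul, map_ofNat, evalSym_pSym,
    show 2 * (k + 1) = (2 * k + 1) + 1 by ring,
    evalSym_pSym] at h5
  rw [h5, sq, show 2 * (k + 1) = (2 * k + 1) + 1 by ring]

theorem pleth_hh_zero (g : SymF) : pleth (hh 0) g = 1 := by simp [pleth, hh]

theorem pleth_hh_succ (g : SymF) (n : ℕ) :
    ((n : SymF) + 1) * pleth (hh (n + 1)) g =
      ∑ i ∈ Finset.range (n + 1), psub (i + 1) g * pleth (hh (n - i)) g := by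
  simp only [pleth, toP_hh]
  rw [hInP_succ, map_smul, Algebra.smul_def, ← mul_assoc]
  have : ((n : SymF) + 1) * algebraMap ℚ SymF ((n : ℚ) + 1)⁻¹ = 1 := by
    rw [show (n : SymF) + 1 = algebraMap ℚ SymF ((n : ℚ) + 1) by simp, ← map_mul,
      mul_inv_cancel₀ (Nat.cast_add_one_ne_zero n), map_one]
  rw [this, one_mul, map_sum]
  simp

theorem evalSym_pleth_recursion (x : ι → R) (n : ℕ) :
    2 * ((n : R) + 1) * evalSym x (pleth (hh (n + 1)) (hh 1 * hh 1 - hh 2)) =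
      ∑ i ∈ Finset.range (n + 1), ((∑ v, x v ^ (i + 1)) ^ 2 - ∑ v, x v ^ (2 * (i + 1))) *
        evalSym x (pleth (hh (n - i)) (hh 1 * hh 1 - hh 2)) := by
  have h := congrArg (evalSym x) (pleth_hh_succ (hh 1 * hh 1 - hh 2) n)
  simp only [map_mul, map_add, map_natCast, map_one, map_sum] at h
  rw [mul_assoc, h, Finset.mul_sum]
  refine Finset.sum_congr rfl fun i _ => ?_
  rw [← two_mul_evalSym_psub, mul_assoc]

end EvalSym

section Injectivity

theorem RingHom.injective_of_surjective_of_isNoetherianRing {A : Type*} [CommRing A]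
    [IsNoetherianRing A] (f : A →+* A) (hf : Function.Surjective f) : Function.Injective f := by
  obtain ⟨n, hn⟩ := monotone_stabilizes_iff_noetherian.mpr ‹IsNoetherianRing A›
    ⟨fun n => RingHom.ker (f ^ n), monotone_nat_of_le_succ fun n a ha => by
      rw [RingHom.mem_ker] at ha ⊢
      rw [pow_succ', RingHom.mul_def, RingHom.comp_apply, ha, map_zero]⟩
  have hsurj : Function.Surjective (f ^ n) := by
    rw [RingHom.coe_pow]
    exact hf.iterate n
  rw [injective_iff_map_eq_zero]
  intro a ha
  obtain ⟨b, rfl⟩ := hsurj a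
  have hb : b ∈ RingHom.ker (f ^ (n + 1)) := by
    rw [RingHom.mem_ker, pow_succ', RingHom.mul_def, RingHom.comp_apply, ha]
  have hb' : b ∈ RingHom.ker (f ^ n) := by
    have := hn (n + 1) (Nat.le_succ n)
    exact (show RingHom.ker (f ^ n) = RingHom.ker (f ^ (n + 1)) from this) ▸ hb
  exact hb'

theorem Subalgebra.mem_of_natCast_mul_mem {A : Type*} [CommRing A] [Algebra ℚ A]
    (S : Subalgebra ℚ A) {n : ℕ} (hn : n ≠ 0) {a : A} (h : (n : A) * a ∈ S) : a ∈ S := by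
  have h1 := S.smul_mem h ((n : ℚ)⁻¹)
  rwa [Algebra.smul_def, ← mul_assoc, ← map_natCast (algebraMap ℚ A), ← map_mul,
    inv_mul_cancel₀ (Nat.cast_ne_zero.mpr hn), map_one, one_mul] at h1

variable {N : ℕ}

theorem coeff_hSeries_X_mem_symmetricSubalgebra (n : ℕ) :
    PowerSeries.coeff n (hSeries (X : Fin N → MvPolynomial (Fin N) ℚ)) ∈
      symmetricSubalgebra (Fin N) ℚ := by
  induction n using Nat.strong_induction_on with
  | _ n ih =>
    cases n with
    | zero => rw [coeff_zero_hSeries]; exact one_mem _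
    | succ n =>
      refine Subalgebra.mem_of_natCast_mul_mem _ (Nat.succ_ne_zero n) ?_
      push_cast
      rw [coeff_hSeries_recursion]
      exact sum_mem fun i _ => mul_mem (psum_isSymmetric (Fin N) ℚ (i + 1)) (ih _ (by omega))

theorem esymm_mem_range_aeval_hSeries {k : ℕ} (hk : k ≤ N) :
    esymm (Fin N) ℚ k ∈ (aeval (R := ℚ) fun i : Fin N =>
      PowerSeries.coeff (i.val + 1) (hSeries (X : Fin N → MvPolynomial (Fin N) ℚ))).range := by
  set A := (aeval (R := ℚ) fun i : Fin N =>
      PowerSeries.coeff (i.val + 1) (hSeries (X : Fin N → MvPolynomial (Fin N) ℚ))).range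
  have hcoeff : ∀ k ≤ N,
      PowerSeries.coeff k (hSeries (X : Fin N → MvPolynomial (Fin N) ℚ)) ∈ A := by
    intro k hk
    cases k with
    | zero => rw [coeff_zero_hSeries]; exact one_mem _
    | succ k => exact ⟨X ⟨k, hk⟩, by simp⟩
  have hp : ∀ k, k + 1 ≤ N → psum (Fin N) ℚ (k + 1) ∈ A := by
    intro k
    induction k using Nat.strong_induction_on with
    | _ k ih =>
      intro hk
      have h := coeff_hSeries_recursion (X : Fin N → MvPolynomial (Fin N) ℚ) k
      rw [Finset.sum_range_succ, Nat.sub_self, coeff_zero_hSeries, mul_one,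
        ← sub_eq_iff_eq_add'] at h
      rw [psum, ← h]
      refine sub_mem (mul_mem (by exact_mod_cast natCast_mem A (k + 1)) (hcoeff _ hk))
        (sum_mem fun i hi => ?_)
      have hi' := Finset.mem_range.mp hi
      exact mul_mem (ih i hi' (by omega)) (hcoeff _ (by omega))
  induction k using Nat.strong_induction_on with
  | _ k ih =>
    rcases Nat.eq_zero_or_pos k with rfl | hk0
    · rw [esymm_zero]; exact one_mem _
    · refine Subalgebra.mem_of_natCast_mul_mem _ hk0.ne' ?_
      rw [mul_esymm_eq_sum]
      have hneg : (-1 : MvPolynomial (Fin N) ℚ) ∈ A := neg_mem (one_mem _)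
      refine mul_mem (pow_mem hneg _) (sum_mem fun a ha => ?_)
      obtain ⟨ha1, ha2⟩ := Finset.mem_filter.mp ha
      have hsum : a.1 + a.2 = k := Finset.HasAntidiagonal.mem_antidiagonal.mp ha1
      refine mul_mem (mul_mem (pow_mem hneg _) (ih _ ha2 (by omega))) ?_
      obtain ⟨j, hj⟩ : ∃ j, a.2 = j + 1 := ⟨a.2 - 1, by omega⟩
      rw [hj]
      exact hp j (by omega)

theorem aeval_hSeries_X_injective :
    Function.Injective (aeval (R := ℚ) fun i : Fin N =>
      PowerSeries.coeff (i.val + 1) (hSeries (X : Fin N → MvPolynomial (Fin N) ℚ))) := by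
  let ψ : MvPolynomial (Fin N) ℚ →ₐ[ℚ] symmetricSubalgebra (Fin N) ℚ :=
    aeval fun i : Fin N => ⟨_, coeff_hSeries_X_mem_symmetricSubalgebra (i.val + 1)⟩
  have hψ (q : MvPolynomial (Fin N) ℚ) : (ψ q : MvPolynomial (Fin N) ℚ) =
      aeval (fun i : Fin N =>
        PowerSeries.coeff (i.val + 1) (hSeries (X : Fin N → MvPolynomial (Fin N) ℚ))) q := by
    rw [← Subalgebra.coe_val, ← AlgHom.comp_apply, comp_aeval]
    rfl
  let φ : MvPolynomial (Fin N) ℚ →ₐ[ℚ] MvPolynomial (Fin N) ℚ :=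
    ((esymmAlgEquiv (Fin N) ℚ (Fintype.card_fin N)).symm : _ →ₐ[ℚ] _).comp ψ
  have hφ : Function.Surjective φ := by
    rw [← AlgHom.range_eq_top, ← top_le_iff, ← adjoin_range_X, Algebra.adjoin_le_iff]
    rintro _ ⟨i, rfl⟩
    obtain ⟨q, hq⟩ := esymm_mem_range_aeval_hSeries (N := N) (k := i.val + 1) i.isLt
    refine ⟨q, ?_⟩
    have : ψ q = ⟨esymm (Fin N) ℚ (i + 1), esymm_isSymmetric (Fin N) ℚ _⟩ :=
      Subtype.ext ((hψ q).trans hq)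
    change (esymmAlgEquiv (Fin N) ℚ (Fintype.card_fin N)).symm (ψ q) = X i
    rw [this, esymmAlgEquiv_symm_apply]
  have hinj : Function.Injective φ :=
    RingHom.injective_of_surjective_of_isNoetherianRing φ.toRingHom hφ
  intro a b hab
  apply hinj
  have : ψ a = ψ b := Subtype.ext (by rw [hψ, hψ]; exact hab)
  change (esymmAlgEquiv (Fin N) ℚ (Fintype.card_fin N)).symm (ψ a) = _
  rw [this]
  rfl

theorem eq_of_evalSym_X_eq {f g : SymF} (K : ℕ)
    (h : ∀ M, K ≤ M → evalSym (X : Fin (M * 2) → MvPolynomial (Fin (M * 2)) ℚ) f =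
      evalSym X g) : f = g := by
  rw [← sub_eq_zero]
  obtain ⟨B, hB⟩ := (f - g).vars.bddAbove
  let M := max K (B + 1)
  have hM : evalSym (X : Fin (M * 2) → MvPolynomial (Fin (M * 2)) ℚ) (f - g) = 0 := by
    rw [map_sub, h M (le_max_left _ _), sub_self]
  obtain ⟨q, hq⟩ := exists_rename_eq_of_vars_subset_range (f - g) (Fin.val : Fin (M * 2) → ℕ)
    Fin.val_injective fun i hi => by
      have h1 : i ≤ B := hB hi
      have h2 : B + 1 ≤ M := le_max_right _ _
      exact ⟨⟨i, by omega⟩, rfl⟩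
  rw [← hq] at hM ⊢
  rw [evalSym, aeval_rename] at hM
  rw [aeval_hSeries_X_injective (hM.trans (map_zero _).symm), map_zero]

end Injectivity

section Partitions

theorem le_getD_zero_iff {l : List ℕ} (hl : l.Pairwise (· ≥ ·)) {r : ℕ} (hr : 1 ≤ r) (k : ℕ) :
    r ≤ l.getD k 0 ↔ k < l.countP (r ≤ ·) := by
  induction l generalizing k with
  | nil => simp; omega
  | cons a l ih =>
    rw [List.pairwise_cons] at hl
    by_cases ha : r ≤ a
    · rw [List.countP_cons_of_pos (by simpa using ha)]
      cases k with
      | zero => simpa using ha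
      | succ k => simpa using ih hl.2 k
    · have h0 : l.countP (r ≤ ·) = 0 := by
        rw [List.countP_eq_zero]
        intro b hb
        have := hl.1 b hb
        simp only [decide_eq_true_eq]
        omega
      rw [List.countP_cons_of_neg (by simpa using ha), h0]
      cases k with
      | zero => simpa using ha
      | succ k => simpa [h0] using ih hl.2 k

theorem sum_range_getD_zero (l : List ℕ) {N : ℕ} (hN : l.length ≤ N) :
    ∑ i ∈ Finset.range N, l.getD i 0 = l.sum := by
  induction l generalizing N with
  | nil => simp
  | cons a l ih =>
    cases N with
    | zero => simp at hN
    | succ N =>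
      rw [Finset.sum_range_succ', List.sum_cons, add_comm a]
      simpa using ih (by simpa using hN)

variable {K : ℕ} (π : Nat.Partition K)

theorem coe_sortedParts : (sortedParts π : Multiset ℕ) = π.parts := by
  simp [sortedParts]

theorem pairwise_sortedParts : (sortedParts π).Pairwise (· ≥ ·) := by
  rw [sortedParts, List.pairwise_reverse]
  exact Multiset.pairwise_sort _ _

theorem sum_sortedParts : (sortedParts π).sum = K := by
  rw [← Multiset.sum_coe, coe_sortedParts, π.parts_sum]

theorem le_getD_sortedParts_iff {r : ℕ} (hr : 1 ≤ r) (k : ℕ) :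
    r ≤ (sortedParts π).getD k 0 ↔ k < (π.parts.filter (fun x => r ≤ x)).card := by
  rw [le_getD_zero_iff (pairwise_sortedParts π) hr, ← Multiset.countP_eq_card_filter,
    ← coe_sortedParts, Multiset.coe_countP]

theorem length_sortedParts_le : (sortedParts π).length ≤ K := by
  conv_rhs => rw [← sum_sortedParts π]
  refine List.length_le_sum_of_one_le _ fun i hi => π.parts_pos ?_
  rwa [← coe_sortedParts]

theorem getD_sortedParts_antitone : Antitone fun k => (sortedParts π).getD k 0 := by
  intro i j hij
  rcases Nat.eq_zero_or_pos ((sortedParts π).getD j 0) with h | h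
  · simp only [h, Nat.zero_le]
  · have := (le_getD_sortedParts_iff π h j).mp le_rfl
    exact (le_getD_sortedParts_iff π h i).mpr (hij.trans_lt this)

theorem eq_of_getD_sortedParts_eq {π ρ : Nat.Partition K}
    (h : ∀ k < K, (sortedParts π).getD k 0 = (sortedParts ρ).getD k 0) : π = ρ := by
  have hle {π ρ : Nat.Partition K}
      (h : ∀ k < K, (sortedParts π).getD k 0 = (sortedParts ρ).getD k 0) :
      (sortedParts π).length ≤ (sortedParts ρ).length := by
    by_contra! hlt
    have h1 := h _ (hlt.trans_le (length_sortedParts_le π))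
    rw [List.getD_eq_getElem _ _ hlt, List.getD_eq_default _ _ le_rfl] at h1
    have := π.parts_pos (i := (sortedParts π)[(sortedParts ρ).length]) (by
      rw [← coe_sortedParts]
      exact Multiset.mem_coe.mpr (List.getElem_mem hlt))
    omega
  have hlist : sortedParts π = sortedParts ρ := by
    refine List.ext_getElem (le_antisymm (hle h) (hle fun k hk => (h k hk).symm))
      fun k hk hk' => ?_
    have := h k (hk.trans_le (length_sortedParts_le π))
    rwa [List.getD_eq_getElem _ _ hk, List.getD_eq_getElem _ _ hk'] at this
  exact Nat.Partition.ext (by rw [← coe_sortedParts, hlist, coe_sortedParts])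

/-- The number of parts that are at least `i` is even for all `i ≥ 1`. -/
def HasEvenConjugate : Prop :=
  ∀ i, 1 ≤ i → Even (π.parts.filter (fun x => i ≤ x)).card

variable {π} in
theorem HasEvenConjugate.getD_two_mul_add_one (h : HasEvenConjugate π) (m : ℕ) :
    (sortedParts π).getD (2 * m + 1) 0 = (sortedParts π).getD (2 * m) 0 := by
  refine le_antisymm (getD_sortedParts_antitone π (Nat.le_succ _)) ?_
  rcases Nat.eq_zero_or_pos ((sortedParts π).getD (2 * m) 0) with h0 | h0
  · omega
  · rw [le_getD_sortedParts_iff π h0]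
    have := (le_getD_sortedParts_iff π h0 (2 * m)).mp le_rfl
    obtain ⟨c, hc⟩ := h _ h0
    omega

variable {π} in
theorem HasEvenConjugate.getD_finProdFinEquiv {M : ℕ} (h : HasEvenConjugate π)
    (i : Fin M × Fin 2) :
    (sortedParts π).getD (finProdFinEquiv i : Fin (M * 2)).val 0 =
      (sortedParts π).getD (2 * i.1.val) 0 := by
  obtain ⟨m, s⟩ := i
  rw [finProdFinEquiv_apply_val]
  fin_cases s
  · simp
  · simpa [add_comm] using h.getD_two_mul_add_one m

theorem lt_card_filter_iff {M : ℕ} {d : Fin M → ℕ} (hd : Antitone d) (r : ℕ) (m : Fin M) :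
    m.val < (Finset.univ.filter fun j => r ≤ d j).card ↔ r ≤ d m := by
  constructor
  · contrapose!
    intro h
    calc (Finset.univ.filter fun j => r ≤ d j).card ≤ (Finset.Iio m).card := by
          refine Finset.card_le_card fun j hj => ?_
          rw [Finset.mem_filter] at hj
          rw [Finset.mem_Iio]
          by_contra! hmj
          exact absurd (hj.2.trans (hd hmj)) (not_le.mpr h)
      _ = m := Fin.card_Iio m
  · intro h
    calc m.val < (Finset.Iic m).card := by rw [Fin.card_Iic]; omega
      _ ≤ _ := by
          refine Finset.card_le_card fun j hj => ?_
          rw [Finset.mem_filter]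
          exact ⟨Finset.mem_univ _, h.trans (hd (Finset.mem_Iic.mp hj))⟩

theorem exists_partition_of_mem_decSeq {M n : ℕ} {d : Fin M → ℕ} (hd : d ∈ decSeq M n) :
    ∃ π : Nat.Partition (2 * n), HasEvenConjugate π ∧
      (fun m : Fin M => (sortedParts π).getD (2 * m.val) 0) = d := by
  obtain ⟨hsum, hanti⟩ := mem_decSeq.mp hd
  let π : Nat.Partition (2 * n) := Nat.Partition.ofSums (2 * n)
    (Finset.univ.val.map d + Finset.univ.val.map d) (by
      rw [Multiset.sum_add, two_mul, ← hsum]; rfl)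
  have hcard : ∀ r, 1 ≤ r → (π.parts.filter (fun x => r ≤ x)).card =
      2 * (Finset.univ.filter fun j => r ≤ d j).card := by
    intro r hr
    have : π.parts.filter (fun x => r ≤ x) =
        (Finset.univ.val.map d + Finset.univ.val.map d).filter (fun x => r ≤ x) := by
      change ((Finset.univ.val.map d + Finset.univ.val.map d).filter (· ≠ 0)).filter _ = _
      rw [Multiset.filter_filter]
      refine Multiset.filter_congr fun x _ => ?_
      omega
    rw [this, Multiset.filter_add, Multiset.card_add, ← two_mul, Multiset.filter_map,
      Multiset.card_map]
    rfl
  refine ⟨π, fun r hr => by rw [hcard r hr]; exact even_two_mul _, funext fun m => ?_⟩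
  refine eq_of_forall_le_iff fun r => ?_
  rcases Nat.eq_zero_or_pos r with rfl | hr
  · simp
  · rw [le_getD_sortedParts_iff π hr, hcard r hr, ← lt_card_filter_iff hanti]
    omega

theorem HasEvenConjugate.mem_decSeq {M n : ℕ} {π : Nat.Partition (2 * n)}
    (h : HasEvenConjugate π) (hM : 2 * n ≤ M * 2) :
    (fun m : Fin M => (sortedParts π).getD (2 * m.val) 0) ∈ decSeq M n := by
  rw [_root_.mem_decSeq]
  refine ⟨?_, fun i j hij => getD_sortedParts_antitone π (Nat.mul_le_mul_left 2 hij)⟩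
  have h1 := sum_range_getD_zero (sortedParts π) ((length_sortedParts_le π).trans hM)
  rw [sum_sortedParts, Finset.sum_range, ← Equiv.sum_comp finProdFinEquiv,
    Fintype.sum_prod_type] at h1
  simp only [h.getD_finProdFinEquiv, Finset.sum_const, Finset.card_univ, Fintype.card_fin,
    smul_eq_mul, ← Finset.mul_sum] at h1
  omega

open scoped Classical in
theorem sum_decSeq_eq_sum_partition {A : Type*} [AddCommMonoid A] {M n : ℕ} (hM : 2 * n ≤ M * 2)
    (F : (Fin M → ℕ) → A) :
    ∑ d ∈ decSeq M n, F d = ∑ π : Nat.Partition (2 * n), if HasEvenConjugate π then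
      F (fun m => (sortedParts π).getD (2 * m.val) 0) else 0 := by
  rw [← Finset.sum_filter]
  symm
  refine Finset.sum_bij (fun π _ m => (sortedParts π).getD (2 * m.val) 0)
    (fun π hπ => (Finset.mem_filter.mp hπ).2.mem_decSeq hM) (fun π hπ ρ hρ hπρ => ?_)
    (fun d hd => ?_) fun _ _ => rfl
  · refine eq_of_getD_sortedParts_eq fun k hk => ?_
    obtain ⟨i, hi⟩ := finProdFinEquiv.surjective (⟨k, hk.trans_le hM⟩ : Fin (M * 2))
    have h1 := (Finset.mem_filter.mp hπ).2.getD_finProdFinEquiv i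
    have h2 := (Finset.mem_filter.mp hρ).2.getD_finProdFinEquiv i
    rw [hi] at h1 h2
    exact h1.trans ((congrFun hπρ i.1).trans h2.symm)
  · obtain ⟨π, hπ, rfl⟩ := exists_partition_of_mem_decSeq hd
    exact ⟨π, Finset.mem_filter.mpr ⟨Finset.mem_univ _, hπ⟩, rfl⟩

end Partitions

section Littlewood

variable {R : Type*} [CommRing R]

theorem evalSym_comp [Algebra ℚ R] {ι κ : Type*} [Fintype ι] [Fintype κ] (x : ι → R)
    (e : κ ≃ ι) : evalSym (x ∘ e) = evalSym x := by
  have : hSeries (x ∘ e) = hSeries x := Equiv.prod_comp e fun v => geomSeries (x v)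
  rw [evalSym, evalSym, this]

theorem alternant_ne_zero [IsDomain R] {N : ℕ} {x : Fin N → R} (hx : Function.Injective x) :
    alternant x (fun i => N - 1 - i.val) ≠ 0 := by
  have h1 : alternant x (fun i => N - 1 - i.val) =
      alternant (x ∘ Fin.revPerm ∘ Fin.revPerm) ((fun i : Fin N => i.val) ∘ Fin.revPerm) := by
    congr 1
    · funext i; simp
    · funext i; simp [Fin.val_rev]; omega
  have h2 : alternant (x ∘ Fin.revPerm ∘ Fin.revPerm) ((fun i : Fin N => i.val) ∘ Fin.revPerm) =
      alternant (x ∘ Fin.revPerm) fun i => i.val :=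
    alternant_comp Fin.revPerm (x ∘ Fin.revPerm) fun i => i.val
  rw [h1, h2]
  exact Matrix.det_vandermonde_ne_zero_iff.mpr (hx.comp Fin.revPerm.injective)

/-- Each entry of `d` repeated twice. -/
def double {M : ℕ} (d : Fin M → ℕ) (i : Fin (M * 2)) : ℕ := d (finProdFinEquiv.symm i).1

theorem alternant_pairExp_spread {M : ℕ} (y : Fin (M * 2) → R) (d : Fin M → ℕ) :
    alternant (y ∘ finProdFinEquiv) (pairExp (spread d)) =
      alternant y fun i => double d i + (M * 2 - 1 - i.val) := by
  rw [← alternant_comp finProdFinEquiv]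
  congr 1
  funext ⟨m, s⟩
  have hm := m.isLt
  have hs := s.isLt
  simp only [pairExp, spread, double, Function.comp_apply, Equiv.symm_apply_apply,
    finProdFinEquiv_apply_val]
  omega

theorem evalSym_pleth_hh_eq_sum [Algebra ℚ R] [IsDomain R] [CharZero R] {M : ℕ}
    {y : Fin (M * 2) → R} (hy : Function.Injective y) (n : ℕ) :
    evalSym y (pleth (hh n) (hh 1 * hh 1 - hh 2)) =
      ∑ d ∈ decSeq M n, evalSym y (jacobiTrudi (double d)).det := by
  have hzero : decSeq M 0 = {0} := by
    ext d
    rw [mem_decSeq, Finset.mem_singleton, Finset.sum_eq_zero_iff]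
    exact ⟨fun h => funext fun m => h.1 m (Finset.mem_univ m),
      fun h => by subst h; exact ⟨fun _ _ => rfl, antitone_const⟩⟩
  have h := coeff_altSum_eq (y ∘ finProdFinEquiv)
    (fun n => evalSym (y ∘ finProdFinEquiv) (pleth (hh n) (hh 1 * hh 1 - hh 2)))
    (by rw [pleth_hh_zero, map_one]) (evalSym_pleth_recursion _) n
  rw [coeff_altSum, coeff_altSum, sum_alternant_pairExp, ← Nat.zero_add (M * (M - 1)),
    sum_alternant_pairExp, hzero, Finset.sum_singleton, mul_left_comm] at h
  have h1 := mul_left_cancel₀ (Nat.cast_ne_zero.mpr M.factorial_ne_zero) h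
  simp only [alternant_pairExp_spread, alternant_eq_evalSym_mul] at h1
  have hdouble : double (0 : Fin M → ℕ) = 0 := rfl
  rw [← Finset.sum_mul, hdouble, det_jacobiTrudi_zero, map_one, one_mul, evalSym_comp] at h1
  exact (mul_right_cancel₀ (alternant_ne_zero hy) h1).symm

end Littlewood

open scoped Classical in
/-- Littlewood's formula: `h_n[e_2]` is the sum of the Schur functions `s_λ` over
all partitions `λ` of `2n` whose conjugate partition has all parts even (the part
`λ'_i` of the conjugate is the number of parts of `λ` that are `≥ i`).  Here
`e_2 = h_1·h_1 - h_2`. -/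
theorem littlewood_hn_e2 (n : ℕ) :
    pleth (hh n) (hh 1 * hh 1 - hh 2) =
      ∑ π : Nat.Partition (2 * n),
        if ∀ i, 1 ≤ i → Even (π.parts.filter (fun x => i ≤ x)).card
        then schur (sortedParts π) else 0 := by
  refine eq_of_evalSym_X_eq n fun M hM => ?_
  have hM' : 2 * n ≤ M * 2 := by omega
  rw [evalSym_pleth_hh_eq_sum X_injective, sum_decSeq_eq_sum_partition hM', map_sum]
  refine Finset.sum_congr rfl fun π _ => ?_
  have hiff : (∀ i, 1 ≤ i → Even (π.parts.filter (fun x => i ≤ x)).card) ↔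
      HasEvenConjugate π := Iff.rfl
  by_cases h : HasEvenConjugate π
  · have hdouble : double (fun m : Fin M => (sortedParts π).getD (2 * m.val) 0) =
        fun i : Fin (M * 2) => (sortedParts π).getD i 0 := by
      funext i
      have := h.getD_finProdFinEquiv (finProdFinEquiv.symm i)
      rw [Equiv.apply_symm_apply] at this
      exact this.symm
    rw [if_pos h, if_pos (hiff.mpr h), hdouble,
      schur_eq_det_jacobiTrudi _ ((length_sortedParts_le π).trans hM')]
  · rw [if_neg h, if_neg (hiff.not.mpr h), map_zero]
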